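/- (Deadline Lemma, part 1) In a regular run, for every track x with significant moments 0 = t_0 < t_1 < t_2 < …: Deadline(x,·) = ∞ on each interval (t_{3i}, t_{3i+1}], and Deadline(x,·) = t_{3i+1} + WaitTime on each interval (t_{3i+1}, t_{3i+3}]. (If the sequence is finite with last element t_k, then Deadline(x,·) = ∞ on (t_k, ∞).) -/

import Mathlib

namespace RailCross

inductive TStat : Type
  | emp | coming | incrossing
deriving DecidableEq

inductive DirV : Type
  | opn | cls
deriving DecidableEq

inductive GateV : Type
  | opened | closed
deriving DecidableEq

/-- `f` is piecewise constant on `[0, ∞)`: for every `τ > 0` there is a finite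
partition `0 = s 0 < s 1 < … < s n = τ` such that `f` is constant on each open
subinterval `(s i, s (i+1))`. -/
def PWC {Y : Type*} (f : ℝ → Y) : Prop :=
  ∀ τ : ℝ, 0 < τ → ∃ n : ℕ, ∃ s : ℕ → ℝ,
    s 0 = 0 ∧ s n = τ ∧ (∀ i < n, s i < s (i + 1)) ∧
    (∀ i < n, ∀ a b : ℝ, s i < a → a < b → b < s (i + 1) → f a = f b)

/-- `v` is the right-hand value `f(t+)`: `f` is constantly `v` on some `(t, t+ε)`. -/
def RightVal {Y : Type*} (f : ℝ → Y) (t : ℝ) (v : Y) : Prop :=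
  ∃ ε : ℝ, 0 < ε ∧ ∀ u : ℝ, t < u → u < t + ε → f u = v

/-- `v` is the left-hand value `f(t−)` (for `t > 0`): `f` is constantly `v` on some `(t-ε, t)`. -/
def LeftVal {Y : Type*} (f : ℝ → Y) (t : ℝ) (v : Y) : Prop :=
  ∃ ε : ℝ, 0 < ε ∧ ε ≤ t ∧ ∀ u : ℝ, t - ε < u → u < t → f u = v

/-- `tm` is the (finite or infinite) increasing sequence of significant moments of a
track with status function `f`; a finite sequence is encoded by letting `tm` take the
value `⊤ = ∞` from some point on. -/
structure TrainMotion (dmin dmax : ℝ) (f : ℝ → TStat) (tm : ℕ → EReal) : Prop where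
  zero : tm 0 = 0
  mono : Monotone tm
  strict : ∀ i, tm i ≠ ⊤ → tm i < tm (i + 1)
  last_div : ∀ k, tm k ≠ ⊤ → tm (k + 1) = ⊤ → 3 ∣ k
  status_empty : ∀ i : ℕ, ∀ u : ℝ, tm (3 * i) ≤ (u : EReal) → (u : EReal) < tm (3 * i + 1) →
    f u = TStat.emp
  status_coming : ∀ i : ℕ, ∀ u : ℝ, tm (3 * i + 1) ≤ (u : EReal) → (u : EReal) < tm (3 * i + 2) →
    f u = TStat.coming
  status_cross : ∀ i : ℕ, ∀ u : ℝ, tm (3 * i + 2) ≤ (u : EReal) → (u : EReal) < tm (3 * i + 3) →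
    f u = TStat.incrossing
  gap : ∀ i : ℕ, ∀ a b : ℝ, tm (3 * i + 1) = (a : EReal) → tm (3 * i + 2) = (b : EReal) →
    dmin ≤ b - a ∧ b - a ≤ dmax

/-- `SafeToOpen(t)`: every track is empty or its deadline is more than `dopen` away. -/
def SafeToOpen {Tracks : Type*} (dopen : ℝ) (trackStatus : Tracks → ℝ → TStat)
    (deadline : Tracks → ℝ → EReal) (t : ℝ) : Prop :=
  ∀ x : Tracks, trackStatus x t = TStat.emp ∨ ((t + dopen : ℝ) : EReal) < deadline x t

/-- A regular run of the railroad-crossing evolving algebra.  `WaitTime = dmin - dclose`. -/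
structure RegularRun (Tracks : Type*) (dmin dmax dopen dclose : ℝ) where
  trackStatus : Tracks → ℝ → TStat
  deadline : Tracks → ℝ → EReal
  dir : ℝ → DirV
  gate : ℝ → GateV
  /-- the right-hand value `Deadline(x, t+)` -/
  deadlinePlus : Tracks → ℝ → EReal
  /-- the right-hand value `Dir(t+)` -/
  dirPlus : ℝ → DirV
  /-- the right-hand value `GateStatus(t+)` -/
  gatePlus : ℝ → GateV
  pwc_ts : ∀ x, PWC (trackStatus x)
  pwc_dl : ∀ x, PWC (deadline x)
  pwc_dir : PWC dir
  pwc_gate : PWC gate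
  dlPlus_spec : ∀ x, ∀ t : ℝ, 0 ≤ t → RightVal (deadline x) t (deadlinePlus x t)
  dirPlus_spec : ∀ t : ℝ, 0 ≤ t → RightVal dir t (dirPlus t)
  gatePlus_spec : ∀ t : ℝ, 0 ≤ t → RightVal gate t (gatePlus t)
  dl_left : ∀ x, ∀ t : ℝ, 0 < t → LeftVal (deadline x) t (deadline x t)
  dir_left : ∀ t : ℝ, 0 < t → LeftVal dir t (dir t)
  gate_left : ∀ t : ℝ, 0 < t → LeftVal gate t (gate t)
  trainMotion : ∀ x, ∃ tm : ℕ → EReal, TrainMotion dmin dmax (trackStatus x) tm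
  dl_init : ∀ x, deadline x 0 = ⊤
  dir_init : dir 0 = DirV.opn
  gate_init : gate 0 = GateV.opened
  dl_step_coming : ∀ x, ∀ t : ℝ, 0 ≤ t → trackStatus x t = TStat.coming → deadline x t = ⊤ →
    deadlinePlus x t = ((t + (dmin - dclose) : ℝ) : EReal)
  dl_step_empty : ∀ x, ∀ t : ℝ, 0 ≤ t → trackStatus x t = TStat.emp → deadline x t ≠ ⊤ →
    deadlinePlus x t = ⊤
  dl_step_other : ∀ x, ∀ t : ℝ, 0 ≤ t →
    ¬(trackStatus x t = TStat.coming ∧ deadline x t = ⊤) →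
    ¬(trackStatus x t = TStat.emp ∧ deadline x t ≠ ⊤) →
    deadlinePlus x t = deadline x t
  dir_step_close : ∀ t : ℝ, 0 ≤ t → (∃ x, deadline x t = (t : EReal)) → dirPlus t = DirV.cls
  dir_step_open : ∀ t : ℝ, 0 ≤ t → (∀ x, deadline x t ≠ (t : EReal)) → dir t = DirV.cls →
    SafeToOpen dopen trackStatus deadline t → dirPlus t = DirV.opn
  dir_step_other : ∀ t : ℝ, 0 ≤ t → (∀ x, deadline x t ≠ (t : EReal)) →
    ¬(dir t = DirV.cls ∧ SafeToOpen dopen trackStatus deadline t) → dirPlus t = dir t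
  gate_step : ∀ t : ℝ, 0 ≤ t →
    gatePlus t = gate t ∨ (dir t = DirV.opn ∧ gatePlus t = GateV.opened) ∨
      (dir t = DirV.cls ∧ gatePlus t = GateV.closed)
  gate_close_bound : ∀ t : ℝ, 0 ≤ t →
    ¬(∀ u ∈ Set.Ioo t (t + dclose), dir u = DirV.cls ∧ gate u = GateV.opened)
  gate_open_bound : ∀ t : ℝ, 0 ≤ t →
    ¬(∀ u ∈ Set.Ioo t (t + dopen), dir u = DirV.opn ∧ gate u = GateV.closed)

/-- A left-continuous `f` with right-hand value `v` at `a` that keeps the value `v` to the right of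
every point of `(a, b)` where it takes it is constantly `v` on `(a, b]`. -/
theorem RightVal.eq_of_forall_leftVal {Y : Type*} {f : ℝ → Y} {a b : ℝ} {v : Y} (hab : a < b)
    (ha : RightVal f a v) (hleft : ∀ t, a < t → t ≤ b → LeftVal f t (f t))
    (hright : ∀ t, a < t → t < b → f t = v → RightVal f t v) : f b = v := by
  by_contra hb
  set B : Set ℝ := {w | a < w ∧ w ≤ b ∧ f w ≠ v}
  have hbB : b ∈ B := ⟨hab, le_rfl, hb⟩
  have hbdd : BddBelow B := ⟨a, fun w hw => hw.1.le⟩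
  have hsb : sInf B ≤ b := csInf_le hbdd hbB
  have hbelow : ∀ w, a < w → w < sInf B → f w = v := by
    intro w hw hws
    by_contra hne
    exact notMem_of_lt_csInf hws hbdd ⟨hw, by linarith, hne⟩
  obtain ⟨ε, hε, hfa⟩ := ha
  have has : a < sInf B := by
    have : a + ε ≤ sInf B := by
      refine le_csInf ⟨b, hbB⟩ fun w hw => ?_
      by_contra! hlt
      exact hw.2.2 (hfa w hw.1 hlt)
    linarith
  have hfs : f (sInf B) = v := by
    obtain ⟨δ, hδ, -, hfδ⟩ := hleft _ has hsb
    obtain ⟨w, hw, hws⟩ := exists_between (max_lt has (sub_lt_self (sInf B) hδ))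
    rw [← hfδ w ((le_max_right _ _).trans_lt hw) hws]
    exact hbelow w ((le_max_left _ _).trans_lt hw) hws
  have hlt : sInf B < b := hsb.lt_of_ne fun h => hb (h ▸ hfs)
  obtain ⟨δ, hδ, hfδ⟩ := hright _ has hlt hfs
  obtain ⟨w, hw, hwδ⟩ := exists_lt_of_csInf_lt ⟨b, hbB⟩ (lt_add_of_pos_right (sInf B) hδ)
  rcases (csInf_le hbdd hw).eq_or_lt with h | h
  · exact hw.2.2 (h ▸ hfs)
  · exact hw.2.2 (hfδ w h hwδ)

/-- The significant moments are nonnegative. -/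
theorem TrainMotion.nonneg {dmin dmax : ℝ} {f : ℝ → TStat} {tm : ℕ → EReal}
    (h : TrainMotion dmin dmax f tm) (n : ℕ) : 0 ≤ tm n :=
  h.zero ▸ h.mono n.zero_le

/-- While a track is empty, the right-hand value of its deadline is `∞`. -/
theorem RegularRun.deadlinePlus_of_emp {Tracks : Type*} {dmin dmax dopen dclose : ℝ}
    (R : RegularRun Tracks dmin dmax dopen dclose) {x : Tracks} {t : ℝ} (ht : 0 ≤ t)
    (he : R.trackStatus x t = TStat.emp) : R.deadlinePlus x t = ⊤ := by
  by_cases hd : R.deadline x t = ⊤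
  · rw [R.dl_step_other x t ht (by simp [he]) (by simp [hd]), hd]
  · exact R.dl_step_empty x t ht he hd

theorem RegularRun.deadline_eq_top {Tracks : Type*} {dmin dmax dopen dclose : ℝ}
    (R : RegularRun Tracks dmin dmax dopen dclose) {x : Tracks} {tm : ℕ → EReal}
    (htm : TrainMotion dmin dmax (R.trackStatus x) tm) {i : ℕ} {u : ℝ}
    (hu : tm (3 * i) < (u : EReal)) (hu' : (u : EReal) ≤ tm (3 * i + 1)) :
    R.deadline x u = ⊤ := by
  have h0 := htm.nonneg (3 * i)
  obtain ⟨c, hc⟩ : ∃ c : ℝ, tm (3 * i) = (c : EReal) :=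
    ⟨_, (EReal.coe_toReal hu.ne_top (EReal.bot_lt_zero.trans_le h0).ne').symm⟩
  rw [hc] at hu h0
  have hcu : c < u := EReal.coe_lt_coe_iff.1 hu
  have hc0 : 0 ≤ c := EReal.coe_nonneg.1 h0
  have key : ∀ t, c ≤ t → t < u → RightVal (R.deadline x) t ⊤ := by
    intro t hct htu
    have he := htm.status_empty i t (hc ▸ EReal.coe_le_coe_iff.2 hct)
      ((EReal.coe_lt_coe_iff.2 htu).trans_le hu')
    rw [← R.deadlinePlus_of_emp (hc0.trans hct) he]
    exact R.dlPlus_spec x t (hc0.trans hct)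
  exact (key c le_rfl hcu).eq_of_forall_leftVal hcu
    (fun t ht _ => R.dl_left x t (hc0.trans_lt ht)) fun t ht htu _ => key t ht.le htu

theorem RegularRun.deadline_eq_coe {Tracks : Type*} {dmin dmax dopen dclose : ℝ}
    (R : RegularRun Tracks dmin dmax dopen dclose) {x : Tracks} {tm : ℕ → EReal}
    (htm : TrainMotion dmin dmax (R.trackStatus x) tm) {i : ℕ} {a u : ℝ}
    (ha : tm (3 * i + 1) = (a : EReal)) (hau : a < u) (hu : (u : EReal) ≤ tm (3 * i + 3)) :
    R.deadline x u = ((a + (dmin - dclose) : ℝ) : EReal) := by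
  have ha0 : 0 ≤ a := EReal.coe_nonneg.1 (ha ▸ htm.nonneg _)
  have hlt : tm (3 * i) < (a : EReal) := by
    rw [← ha]
    refine htm.strict _ fun h => EReal.coe_ne_top a ?_
    rw [← ha, ← top_le_iff, ← h]
    exact htm.mono (Nat.le_succ _)
  have hcoming : R.trackStatus x a = TStat.coming := by
    refine htm.status_coming i a ha.le ?_
    rw [← ha]
    exact htm.strict _ (ha ▸ EReal.coe_ne_top a)
  have hR := R.dlPlus_spec x a ha0
  rw [R.dl_step_coming x a ha0 hcoming (R.deadline_eq_top htm hlt ha.ge)] at hR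
  refine hR.eq_of_forall_leftVal hau (fun t ht _ => R.dl_left x t (ha0.trans_lt ht)) ?_
  intro t hat htu hd
  have ht0 := ha0.trans hat.le
  have hne : R.trackStatus x t ≠ TStat.emp := by
    rcases lt_or_ge (t : EReal) (tm (3 * i + 2)) with h | h
    · simp [htm.status_coming i t (ha ▸ EReal.coe_le_coe_iff.2 hat.le) h]
    · simp [htm.status_cross i t h ((EReal.coe_lt_coe_iff.2 htu).trans_le hu)]
  rw [← hd, ← R.dl_step_other x t ht0 (fun h => EReal.coe_ne_top _ (hd.symm.trans h.2))
    fun h => hne h.1]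
  exact R.dlPlus_spec x t ht0

theorem deadline_lemma_part1 {Tracks : Type*} [Fintype Tracks] [Nonempty Tracks]
    {dmin dmax dopen dclose : ℝ}
    (hdmin : 0 < dmin) (hdmax : 0 < dmax) (hdopen : 0 < dopen) (hdclose : 0 < dclose)
    (hcm : dclose < dmin) (hmm : dmin ≤ dmax)
    (R : RegularRun Tracks dmin dmax dopen dclose)
    (x : Tracks) (tm : ℕ → EReal) (htm : TrainMotion dmin dmax (R.trackStatus x) tm) :
    (∀ i : ℕ, ∀ u : ℝ, tm (3 * i) < (u : EReal) → (u : EReal) ≤ tm (3 * i + 1) →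
      R.deadline x u = ⊤) ∧
    (∀ i : ℕ, ∀ a u : ℝ, tm (3 * i + 1) = (a : EReal) → a < u → (u : EReal) ≤ tm (3 * i + 3) →
      R.deadline x u = ((a + (dmin - dclose) : ℝ) : EReal)) :=
  ⟨fun _ _ => R.deadline_eq_top htm, fun _ _ _ => R.deadline_eq_coe htm⟩

end RailCross
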